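/- Let a be a probability distribution with V(a) > 0, let (t_n) be a moderate sequence, and for x ∈ ℝ set k_n(a,x) = exp( n·H(a) + x·n·t_n ). Then: (i) for every x ≤ 0, lim_{n→∞} (1/(n t_n²)) · ln[ ∑_{1 ≤ i ≤ k_n(a,x)} (a^{⊗n})^↓_i ] = −x²/(2 V(a)); and (ii) for every x ≥ 0, lim_{n→∞} (1/(n t_n²)) · ln[ ∑_{k_n(a,x) ≤ i ≤ d^n} (a^{⊗n})^↓_i ] = −x²/(2 V(a)), where the index i ranges over the positions of the non-increasingly sorted vector (a^{⊗n})^↓. -/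

import Mathlib

open Finset Filter Real Topology

noncomputable section

/-- A probability distribution on a finite type: nonnegative entries summing to 1. -/
def IsProbDist {α : Type*} [Fintype α] (a : α → ℝ) : Prop :=
  (∀ i, 0 ≤ a i) ∧ ∑ i, a i = 1

/-- A sharp distribution: a single entry equal to 1, all others 0. -/
def IsSharp {α : Type*} [Fintype α] (a : α → ℝ) : Prop :=
  ∃ i, a i = 1 ∧ ∀ j, j ≠ i → a j = 0

/-- The uniform distribution: all entries equal to `1 / |α|`. -/
def IsUniform {α : Type*} [Fintype α] (a : α → ℝ) : Prop :=
  ∀ i, a i = 1 / (Fintype.card α : ℝ)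

/-- Tensor (Kronecker) product of two vectors. -/
def tensor {α β : Type*} (a : α → ℝ) (b : β → ℝ) : α × β → ℝ :=
  fun x => a x.1 * b x.2

/-- `n`-fold tensor power of a vector. -/
def tpow {α : Type*} (a : α → ℝ) (n : ℕ) : (Fin n → α) → ℝ :=
  fun f => ∏ j, a (f j)

/-- Shannon entropy (natural logarithm, with the convention `0 · ln 0 = 0`). -/
def shannonH {α : Type*} [Fintype α] (a : α → ℝ) : ℝ :=
  -∑ i, a i * Real.log (a i)

/-- Entropy variance `V(a) = ∑ i, a i (ln a i + H(a))²`. -/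
def entV {α : Type*} [Fintype α] (a : α → ℝ) : ℝ :=
  ∑ i, a i * (Real.log (a i) + shannonH a) ^ 2

/-- Relative entropy `D(a‖b)`. -/
def relD {α : Type*} [Fintype α] (a b : α → ℝ) : ℝ :=
  ∑ i, a i * Real.log (a i / b i)

/-- Relative entropy variance `V(a‖b)`. -/
def relV {α : Type*} [Fintype α] (a b : α → ℝ) : ℝ :=
  ∑ i, a i * (Real.log (a i / b i) - relD a b) ^ 2

/-- Total variation distance. -/
def tvd {α : Type*} [Fintype α] (a b : α → ℝ) : ℝ :=
  (1 / 2) * ∑ i, |a i - b i|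

/-- Fidelity `F(a,b) = (∑ i √(a i · b i))²`. -/
def fid {α : Type*} [Fintype α] (a b : α → ℝ) : ℝ :=
  (∑ i, Real.sqrt (a i * b i)) ^ 2

/-- The entries of `a` sorted in non-increasing order, as a vector on `Fin (card α)`. -/
def descSorted {α : Type*} [Fintype α] (a : α → ℝ) : Fin (Fintype.card α) → ℝ :=
  fun i =>
    a ((Fintype.equivFin α).symm
      (Tuple.sort (fun j => -a ((Fintype.equivFin α).symm j)) i))

/-- `headSum a K = ∑_{1 ≤ i ≤ K} a^↓_i` (1-based indices `i`, comparison `(i : ℝ) ≤ K`,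
equivalently `i ≤ ⌊K⌋`). -/
def headSum {α : Type*} [Fintype α] (a : α → ℝ) (K : ℝ) : ℝ :=
  ∑ i ∈ Finset.univ.filter (fun i : Fin (Fintype.card α) => ((i : ℕ) + 1 : ℝ) ≤ K),
    descSorted a i

/-- `tailSum a K = ∑_{i ≥ K} a^↓_i` (1-based indices `i`, comparison `K ≤ (i : ℝ)`,
equivalently `i ≥ ⌈K⌉`). -/
def tailSum {α : Type*} [Fintype α] (a : α → ℝ) (K : ℝ) : ℝ :=
  ∑ i ∈ Finset.univ.filter (fun i : Fin (Fintype.card α) => K ≤ ((i : ℕ) + 1 : ℝ)),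
    descSorted a i

/-- `a` majorises `b` (written `a ≻ b`): every partial sum of the non-increasingly sorted
`a` dominates the corresponding partial sum of sorted `b` (shorter vectors padded with zeros). -/
def Maj {α β : Type*} [Fintype α] [Fintype β] (a : α → ℝ) (b : β → ℝ) : Prop :=
  ∀ j : ℕ, headSum b (j : ℝ) ≤ headSum a (j : ℝ)

/-- `a ≻_ε b`: approximate majorisation (from above) with total variation error:
there is a probability distribution `b̃` with `a ≻ b̃` and `δ(b, b̃) ≤ ε`. -/
def ApproxMajTV {α β : Type*} [Fintype α] [Fintype β] (a : α → ℝ) (b : β → ℝ) (ε : ℝ) : Prop :=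
  ∃ bt : β → ℝ, IsProbDist bt ∧ Maj a bt ∧ tvd b bt ≤ ε

/-- `a ≺_ε b`: approximate majorisation (from below) with total variation error:
there is a probability distribution `b̃` with `a ≺ b̃` and `δ(b, b̃) ≤ ε`. -/
def ApproxSubMajTV {α β : Type*} [Fintype α] [Fintype β] (a : α → ℝ) (b : β → ℝ) (ε : ℝ) : Prop :=
  ∃ bt : β → ℝ, IsProbDist bt ∧ Maj bt a ∧ tvd b bt ≤ ε

/-- A moderate sequence: `t n → 0` and `√n · t n → +∞`. -/
def ModerateSeq (t : ℕ → ℝ) : Prop :=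
  Tendsto t atTop (𝓝 0) ∧ Tendsto (fun n : ℕ => Real.sqrt (n : ℝ) * t n) atTop atTop

/-- The uniform distribution on `Fin d`. -/
def unif (d : ℕ) : Fin d → ℝ := fun _ => 1 / (d : ℝ)

/-- The embedding map `Γ` associated with `γ_i = c_i / N`: for each `i` it produces
`c_i` entries equal to `a_i / c_i`. -/
def embed {d : ℕ} (c : Fin d → ℕ) (a : Fin d → ℝ) : (Σ i : Fin d, Fin (c i)) → ℝ :=
  fun x => a x.1 / (c x.1 : ℝ)

/-- Cut-and-pile modification of the sorted version of `a`, with cut at `K`: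
the first entry absorbs the total mass of entries at (1-based) positions `≥ K`,
entries at positions `1 < i < K` are unchanged, and entries at positions `≥ K` are set to 0. -/
def cutAndPile {α : Type*} [Fintype α] (a : α → ℝ) (K : ℝ) : Fin (Fintype.card α) → ℝ :=
  fun i =>
    if (i : ℕ) = 0 then descSorted a i + tailSum a K
    else if ((i : ℕ) + 1 : ℝ) < K then descSorted a i else 0

lemma sum_filter_le_sum_filter_of_pos {α : Type*} [Fintype α] {w : α → ℝ} (hw : ∀ i, 0 ≤ w i)
    {p q : α → Prop} [DecidablePred p] [DecidablePred q] (h : ∀ i, 0 < w i → p i → q i) :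
    ∑ i with p i, w i ≤ ∑ i with q i, w i := by
  rw [Finset.sum_filter, Finset.sum_filter]
  refine Finset.sum_le_sum fun i _ => ?_
  rcases (hw i).eq_or_lt with h0 | h0
  · simp [← h0]
  · by_cases hp : p i
    · simp [hp, h i h0 hp]
    · simp only [hp, if_false]
      split_ifs
      exacts [hw i, le_rfl]

/-! ### Sums of the largest and of the smallest entries -/

/-- The bijection enumerating the entries of `w` in non-increasing order. -/
def sortEquiv {α : Type*} [Fintype α] (w : α → ℝ) : Fin (Fintype.card α) ≃ α :=
  (Tuple.sort (fun j => -w ((Fintype.equivFin α).symm j))).trans (Fintype.equivFin α).symm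

lemma descSorted_eq {α : Type*} [Fintype α] (w : α → ℝ) (i : Fin (Fintype.card α)) :
    descSorted w i = w (sortEquiv w i) := rfl

lemma descSorted_antitone {α : Type*} [Fintype α] (w : α → ℝ) : Antitone (descSorted w) := by
  intro i j hij
  have h := Tuple.monotone_sort (fun j => -w ((Fintype.equivFin α).symm j)) hij
  exact neg_le_neg_iff.mp h

lemma sum_filter_eq_sum_descSorted {α : Type*} [Fintype α] (w : α → ℝ) (p : ℝ → Prop)
    [DecidablePred p] :
    ∑ f with p (w f), w f = ∑ i with p (descSorted w i), descSorted w i := by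
  rw [Finset.sum_filter, Finset.sum_filter]
  exact ((sortEquiv w).sum_comp (fun f => if p (w f) then w f else 0)).symm

lemma IsProbDist.descSorted {α : Type*} [Fintype α] {w : α → ℝ} (hw : IsProbDist w) :
    IsProbDist (descSorted w) :=
  ⟨fun _ => hw.1 _, ((sortEquiv w).sum_comp w).trans hw.2⟩

lemma IsProbDist.succ_mul_descSorted_le_one {α : Type*} [Fintype α] {w : α → ℝ}
    (hw : IsProbDist w) (i : Fin (Fintype.card α)) :
    ((i : ℕ) + 1 : ℝ) * _root_.descSorted w i ≤ 1 := by
  calc ((i : ℕ) + 1 : ℝ) * _root_.descSorted w i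
      = ∑ _j ∈ Finset.Iic i, _root_.descSorted w i := by simp
    _ ≤ ∑ j ∈ Finset.Iic i, _root_.descSorted w j :=
        Finset.sum_le_sum fun j hj => descSorted_antitone w (Finset.mem_Iic.mp hj)
    _ ≤ ∑ j, _root_.descSorted w j :=
        Finset.sum_le_sum_of_subset_of_nonneg (Finset.subset_univ _)
          fun j _ _ => hw.descSorted.1 j
    _ = 1 := hw.descSorted.2

lemma card_filter_succ_le_le {m : ℕ} {K : ℝ} (hK : 0 ≤ K) :
    (#{i : Fin m | ((i : ℕ) + 1 : ℝ) ≤ K} : ℝ) ≤ K := by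
  have h : #{i : Fin m | ((i : ℕ) + 1 : ℝ) ≤ K} ≤ #(Finset.range ⌊K⌋₊) := by
    refine Finset.card_le_card_of_injOn (fun i => (i : ℕ)) ?_ (fun i _ j _ hij => Fin.ext hij)
    intro i hi
    simp only [Finset.coe_filter, Finset.mem_univ, true_and, Set.mem_ofPred_eq] at hi
    simp only [Finset.coe_range, Set.mem_Iio]
    exact Nat.lt_of_succ_le (Nat.le_floor (by push_cast; exact hi))
  rw [Finset.card_range] at h
  exact (Nat.cast_le.mpr h).trans (Nat.floor_le hK)

lemma sum_filter_and_le_le_mul {m : ℕ} {v : Fin m → ℝ} {K θ : ℝ} (hK : 0 ≤ K) (hθ : 0 ≤ θ) :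
    ∑ i with v i ≤ θ ∧ ((i : ℕ) + 1 : ℝ) ≤ K, v i ≤ K * θ := by
  calc ∑ i with v i ≤ θ ∧ ((i : ℕ) + 1 : ℝ) ≤ K, v i
      ≤ #{i : Fin m | v i ≤ θ ∧ ((i : ℕ) + 1 : ℝ) ≤ K} • θ :=
        Finset.sum_le_card_nsmul _ _ _ fun i hi => (Finset.mem_filter.mp hi).2.1
    _ ≤ K * θ := by
        rw [nsmul_eq_mul]
        refine mul_le_mul_of_nonneg_right (le_trans ?_ (card_filter_succ_le_le (m := m) hK)) hθ
        refine Nat.cast_le.mpr (Finset.card_le_card fun i hi => ?_)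
        exact Finset.mem_filter.mpr ⟨Finset.mem_univ i, (Finset.mem_filter.mp hi).2.2⟩

lemma IsProbDist.headSum_le_one {α : Type*} [Fintype α] {w : α → ℝ} (hw : IsProbDist w) (K : ℝ) :
    headSum w K ≤ 1 :=
  (Finset.sum_le_sum_of_subset_of_nonneg (Finset.subset_univ _)
    fun j _ _ => hw.descSorted.1 j).trans_eq hw.descSorted.2

lemma IsProbDist.headSum_le {α : Type*} [Fintype α] {w : α → ℝ} (hw : IsProbDist w) {K θ : ℝ}
    (hK : 0 ≤ K) (hθ : 0 ≤ θ) : headSum w K ≤ ∑ f with θ < w f, w f + K * θ := by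
  have h := sum_filter_and_le_le_mul (v := _root_.descSorted w) hK hθ
  rw [sum_filter_eq_sum_descSorted w (fun z => θ < z), headSum]
  refine le_trans ?_ (add_le_add_right h _)
  simp only [Finset.sum_filter]
  rw [← Finset.sum_add_distrib]
  refine Finset.sum_le_sum fun i _ => ?_
  have := hw.descSorted.1 i
  by_cases h1 : ((i : ℕ) + 1 : ℝ) ≤ K <;> by_cases h2 : θ < _root_.descSorted w i <;>
    simp [h1, h2, not_le.mpr, not_lt.mp, this]

lemma IsProbDist.le_headSum {α : Type*} [Fintype α] {w : α → ℝ} (hw : IsProbDist w) {K : ℝ} :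
    ∑ f with 1 ≤ K * w f, w f ≤ headSum w K := by
  rw [sum_filter_eq_sum_descSorted w (fun z => 1 ≤ K * z), headSum]
  refine sum_filter_le_sum_filter_of_pos hw.descSorted.1 fun i hi h => ?_
  exact le_of_mul_le_mul_right ((hw.succ_mul_descSorted_le_one i).trans h) hi

lemma IsProbDist.tailSum_le {α : Type*} [Fintype α] {w : α → ℝ} (hw : IsProbDist w) {K : ℝ} :
    tailSum w K ≤ ∑ f with K * w f ≤ 1, w f := by
  rw [sum_filter_eq_sum_descSorted w (fun z => K * z ≤ 1), tailSum]
  refine sum_filter_le_sum_filter_of_pos hw.descSorted.1 fun i hi h => ?_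
  exact (mul_le_mul_of_nonneg_right h hi.le).trans (hw.succ_mul_descSorted_le_one i)

lemma IsProbDist.le_tailSum_add {α : Type*} [Fintype α] {w : α → ℝ} (hw : IsProbDist w) {K θ : ℝ}
    (hK : 0 ≤ K) (hθ : 0 ≤ θ) : ∑ f with w f ≤ θ, w f ≤ tailSum w K + K * θ := by
  have h := sum_filter_and_le_le_mul (v := _root_.descSorted w) hK hθ
  rw [sum_filter_eq_sum_descSorted w (fun z => z ≤ θ), tailSum]
  refine le_trans ?_ (add_le_add_right h _)
  simp only [Finset.sum_filter]
  rw [← Finset.sum_add_distrib]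
  refine Finset.sum_le_sum fun i _ => ?_
  have := hw.descSorted.1 i
  rcases le_total K ((i : ℕ) + 1 : ℝ) with h1 | h1 <;> split_ifs <;> grind

/-! ### Cumulant generating functions and large deviations with quadratic rate -/

lemma tendsto_log_mgf_div_sq {ι : Type*} [Fintype ι] {a Y : ι → ℝ} (h1 : ∑ i, a i = 1)
    (h2 : ∑ i, a i * Y i = 0) :
    Tendsto (fun u => Real.log (∑ i, a i * Real.exp (u * Y i)) / u ^ 2) (𝓝[≠] 0)
      (𝓝 ((∑ i, a i * Y i ^ 2) / 2)) := by
  set V := ∑ i, a i * Y i ^ 2 with hV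
  have hM : (fun u : ℝ => ∑ i, a i * Real.exp (u * Y i) - 1 - V / 2 * u ^ 2)
      =o[𝓝 0] fun u => u ^ 2 := by
    have hterm : ∀ i ∈ (Finset.univ : Finset ι),
        (fun u : ℝ => a i * (Real.exp (u * Y i) - ∑ j ∈ Finset.range 3, (u * Y i) ^ j / j.factorial))
          =o[𝓝 0] fun u => u ^ 2 := by
      intro i _
      have ht : Tendsto (fun u : ℝ => u * Y i) (𝓝 0) (𝓝 0) := by
        have : Continuous fun u : ℝ => u * Y i := by fun_prop
        simpa using this.tendsto 0
      have h := (Real.exp_sub_sum_range_succ_isLittleO_pow 2).comp_tendsto ht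
      refine Asymptotics.IsLittleO.const_mul_left (h.trans_isBigO ?_) _
      refine Asymptotics.IsBigO.of_bound (Y i ^ 2) (Eventually.of_forall fun u => ?_)
      simp [mul_pow, mul_comm]
    refine (Asymptotics.IsLittleO.fun_sum hterm).congr_left fun u => ?_
    have e : ∀ i, a i * (Real.exp (u * Y i) - ∑ j ∈ Finset.range 3, (u * Y i) ^ j / j.factorial)
        = a i * Real.exp (u * Y i) - a i - u * (a i * Y i) - u ^ 2 / 2 * (a i * Y i ^ 2) := by
      intro i
      simp [Finset.sum_range_succ, Nat.factorial]
      ring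
    simp only [e, Finset.sum_sub_distrib, ← Finset.mul_sum, h1, h2, ← hV]
    ring
  have hz : (fun u : ℝ => ∑ i, a i * Real.exp (u * Y i) - 1) =O[𝓝 0] fun u => u ^ 2 := by
    have hq : (fun u : ℝ => V / 2 * u ^ 2) =O[𝓝 0] fun u => u ^ 2 :=
      Asymptotics.isBigO_const_mul_self _ _ _
    exact (hM.isBigO.add hq).congr_left fun u => by ring
  have hM1 : Tendsto (fun u : ℝ => ∑ i, a i * Real.exp (u * Y i)) (𝓝 0) (𝓝 1) := by
    have : Continuous fun u : ℝ => ∑ i, a i * Real.exp (u * Y i) := by fun_prop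
    simpa [h1] using this.tendsto 0
  have hlog := ((hasDerivAt_iff_isLittleO.mp (Real.hasDerivAt_log one_ne_zero)).comp_tendsto
    hM1).trans_isBigO hz
  have hsum : (fun u : ℝ => Real.log (∑ i, a i * Real.exp (u * Y i)) - V / 2 * u ^ 2)
      =o[𝓝 0] fun u => u ^ 2 := by
    refine (hlog.add hM).congr_left fun u => ?_
    simp
  have hlim := (hsum.mono (nhdsWithin_le_nhds (s := {0}ᶜ))).tendsto_div_nhds_zero.add_const (V / 2)
  rw [zero_add] at hlim
  refine hlim.congr' ?_
  filter_upwards [self_mem_nhdsWithin] with u hu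
  have hu : u ≠ 0 := hu
  field_simp
  ring

section LargeDeviations

variable {Ω : ℕ → Type*} [∀ n, Fintype (Ω n)] {w Z : ∀ n, Ω n → ℝ} {r : ℕ → ℝ} {V : ℝ}

lemma eventually_le_exp_and_exp_le {E : ℕ → ℝ} {c ε : ℝ} (hr : Tendsto r atTop atTop)
    (hE : ∀ n, 0 < E n) (h : Tendsto (fun n => Real.log (E n) / r n) atTop (𝓝 c)) (hε : 0 < ε) :
    ∀ᶠ n in atTop, E n ≤ Real.exp (r n * (c + ε)) ∧ Real.exp (r n * (c - ε)) ≤ E n := by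
  filter_upwards [hr.eventually_gt_atTop 0, h.eventually_lt_const (show c < c + ε by linarith),
    h.eventually_const_lt (show c - ε < c by linarith)] with n hn h1 h2
  rw [div_lt_iff₀ hn] at h1
  rw [lt_div_iff₀ hn] at h2
  rw [← Real.log_le_iff_le_exp (hE n), ← Real.le_log_iff_exp_le (hE n)]
  constructor <;> linarith

lemma eventually_two_mul_exp_le (hr : Tendsto r atTop atTop) {b c : ℝ} (hbc : b < c) :
    ∀ᶠ n in atTop, 2 * Real.exp (r n * b) ≤ Real.exp (r n * c) := by
  filter_upwards [(hr.atTop_mul_const (sub_pos.mpr hbc)).eventually_ge_atTop (Real.log 2)] with n hn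
  calc 2 * Real.exp (r n * b) = Real.exp (Real.log 2) * Real.exp (r n * b) := by
        rw [Real.exp_log two_pos]
    _ = Real.exp (Real.log 2 + r n * b) := (Real.exp_add _ _).symm
    _ ≤ Real.exp (r n * c) := Real.exp_le_exp.mpr (by linarith)

lemma sum_filter_le_exp_mul {α : Type*} [Fintype α] {v z : α → ℝ} (hv : ∀ f, 0 ≤ v f)
    {p : α → Prop} [DecidablePred p] {s b ξ η : ℝ}
    (h : ∀ f, p f → s * z f * ξ ≤ b + s * z f * η) :
    ∑ f with p f, v f * Real.exp (s * z f * ξ)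
      ≤ Real.exp b * ∑ f, v f * Real.exp (s * z f * η) := by
  rw [Finset.mul_sum, Finset.sum_filter]
  refine Finset.sum_le_sum fun f _ => ?_
  split_ifs with hf
  · calc v f * Real.exp (s * z f * ξ) ≤ v f * Real.exp (b + s * z f * η) :=
          mul_le_mul_of_nonneg_left (Real.exp_le_exp.mpr (h f hf)) (hv f)
      _ = _ := by rw [Real.exp_add]; ring
  · have := hv f
    positivity

/-- Upper bound of Gärtner-Ellis type for a quadratic limiting cumulant generating function. -/
lemma eventually_tail_le (hw : ∀ n f, 0 ≤ w n f) (hr : Tendsto r atTop atTop) (hV : 0 < V)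
    (hpos : ∀ n ξ, 0 < ∑ f, w n f * Real.exp (r n * Z n f * ξ))
    (hlim : ∀ ξ, Tendsto (fun n => Real.log (∑ f, w n f * Real.exp (r n * Z n f * ξ)) / r n)
      atTop (𝓝 (ξ ^ 2 * (V / 2)))) {y ε : ℝ} (hy : 0 ≤ y) (hε : 0 < ε) :
    ∀ᶠ n in atTop, ∑ f with y ≤ Z n f, w n f ≤ Real.exp (r n * (-y ^ 2 / (2 * V) + ε)) := by
  filter_upwards [hr.eventually_gt_atTop 0,
    eventually_le_exp_and_exp_le hr (fun n => hpos n (y / V)) (hlim (y / V)) hε] with n hn h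
  have h1 := sum_filter_le_exp_mul (z := Z n) (hw n) (p := fun f => y ≤ Z n f) (s := r n)
    (b := -(r n * y * (y / V))) (ξ := 0) (η := y / V) fun f hf => by
      have : r n * y * (y / V) ≤ r n * Z n f * (y / V) := by gcongr
      linarith
  simp only [mul_zero, Real.exp_zero, mul_one] at h1
  refine (h1.trans (mul_le_mul_of_nonneg_left h.1 (Real.exp_nonneg _))).trans_eq ?_
  rw [← Real.exp_add]
  congr 1
  field_simp
  ring

/-- Lower bound of Gärtner-Ellis type for a quadratic limiting cumulant generating function. -/
lemma eventually_le_tail (hw : ∀ n f, 0 ≤ w n f) (hr : Tendsto r atTop atTop) (hV : 0 < V)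
    (hpos : ∀ n ξ, 0 < ∑ f, w n f * Real.exp (r n * Z n f * ξ))
    (hlim : ∀ ξ, Tendsto (fun n => Real.log (∑ f, w n f * Real.exp (r n * Z n f * ξ)) / r n)
      atTop (𝓝 (ξ ^ 2 * (V / 2)))) {y ε : ℝ} (hy : 0 ≤ y) (hε : 0 < ε) :
    ∀ᶠ n in atTop, Real.exp (r n * (-y ^ 2 / (2 * V) - ε)) ≤ ∑ f with y ≤ Z n f, w n f := by
  obtain ⟨δ, hδ, hδε⟩ : ∃ δ : ℝ, 0 < δ ∧
      -y ^ 2 / (2 * V) - ε < -y ^ 2 / (2 * V) - (2 * (y * δ) / V + 7 * δ ^ 2 / (4 * V)) := by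
    have hc : Continuous fun δ : ℝ => 2 * (y * δ) / V + 7 * δ ^ 2 / (4 * V) := by fun_prop
    have h0 : ∀ᶠ δ in 𝓝[>] (0 : ℝ), 2 * (y * δ) / V + 7 * δ ^ 2 / (4 * V) < ε :=
      (hc.tendsto' 0 0 (by simp)).eventually_lt_const hε |>.filter_mono nhdsWithin_le_nhds
    obtain ⟨δ, h, hδ⟩ := (h0.and self_mem_nhdsWithin).exists
    exact ⟨δ, hδ, by linarith⟩
  set ξ := (y + δ) / V with hξ
  set η := δ / V with hη
  set κ := δ ^ 2 / (8 * V) with hκ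
  have hξ0 : 0 < ξ := by positivity
  have hη0 : 0 < η := by positivity
  have hκ0 : 0 < κ := by positivity
  have hgap : ξ ^ 2 * (V / 2) - 3 * κ < ξ ^ 2 * (V / 2) - 2 * κ := by linarith
  have hgap' : ξ ^ 2 * (V / 2) - 2 * κ < ξ ^ 2 * (V / 2) - κ := by linarith
  filter_upwards [hr.eventually_gt_atTop 0,
    eventually_le_exp_and_exp_le hr (fun n => hpos n ξ) (hlim ξ) hκ0,
    eventually_le_exp_and_exp_le hr (fun n => hpos n (ξ - η)) (hlim (ξ - η)) hκ0,
    eventually_le_exp_and_exp_le hr (fun n => hpos n (ξ + η)) (hlim (ξ + η)) hκ0,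
    eventually_two_mul_exp_le hr hgap, eventually_two_mul_exp_le hr hgap',
    eventually_two_mul_exp_le hr hδε] with n hn h h₁ h₂ hg hg' hδn
  set E := ∑ f, w n f * Real.exp (r n * Z n f * ξ) with hE
  have hlow : ∑ f with Z n f < y, w n f * Real.exp (r n * Z n f * ξ)
      ≤ Real.exp (r n * (ξ ^ 2 * (V / 2) - 3 * κ)) := by
    refine (sum_filter_le_exp_mul (z := Z n) (hw n) (b := r n * y * η) (η := ξ - η)
      fun f hf => ?_).trans
      ((mul_le_mul_of_nonneg_left h₁.1 (Real.exp_nonneg _)).trans_eq ?_)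
    · have : r n * Z n f * η ≤ r n * y * η := by gcongr
      linarith
    · rw [← Real.exp_add, hξ, hη, hκ]
      congr 1
      field_simp
      ring
  have hhigh : ∑ f with y + 2 * δ < Z n f, w n f * Real.exp (r n * Z n f * ξ)
      ≤ Real.exp (r n * (ξ ^ 2 * (V / 2) - 3 * κ)) := by
    refine (sum_filter_le_exp_mul (z := Z n) (hw n) (b := -(r n * (y + 2 * δ) * η)) (η := ξ + η)
      fun f hf => ?_).trans
      ((mul_le_mul_of_nonneg_left h₂.1 (Real.exp_nonneg _)).trans_eq ?_)
    · have : r n * (y + 2 * δ) * η ≤ r n * Z n f * η := by gcongr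
      linarith
    · rw [← Real.exp_add, hξ, hη, hκ]
      congr 1
      field_simp
      ring
  have hmid : ∑ f with y ≤ Z n f ∧ Z n f ≤ y + 2 * δ, w n f * Real.exp (r n * Z n f * ξ)
      ≤ Real.exp (r n * (y + 2 * δ) * ξ) * ∑ f with y ≤ Z n f, w n f := by
    rw [Finset.mul_sum, Finset.sum_filter, Finset.sum_filter]
    refine Finset.sum_le_sum fun f _ => ?_
    have := hw n f
    by_cases hf : y ≤ Z n f ∧ Z n f ≤ y + 2 * δ
    · rw [if_pos hf, if_pos hf.1, mul_comm]
      have := hf.2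
      gcongr
    · rw [if_neg hf]
      split_ifs <;> positivity
  have hsplit : E ≤ ∑ f with Z n f < y, w n f * Real.exp (r n * Z n f * ξ)
      + ∑ f with y + 2 * δ < Z n f, w n f * Real.exp (r n * Z n f * ξ)
      + ∑ f with y ≤ Z n f ∧ Z n f ≤ y + 2 * δ, w n f * Real.exp (r n * Z n f * ξ) := by
    simp only [hE, Finset.sum_filter, ← Finset.sum_add_distrib]
    refine Finset.sum_le_sum fun f _ => ?_
    have : 0 ≤ w n f * Real.exp (r n * Z n f * ξ) := mul_nonneg (hw n f) (Real.exp_nonneg _)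
    split_ifs <;> grind
  have hkey : Real.exp (r n * (ξ ^ 2 * (V / 2) - 2 * κ))
      ≤ Real.exp (r n * (y + 2 * δ) * ξ) * ∑ f with y ≤ Z n f, w n f := by
    linarith [h.2]
  have hexp : Real.exp (r n * (ξ ^ 2 * (V / 2) - 2 * κ))
      = Real.exp (r n * (y + 2 * δ) * ξ)
        * Real.exp (r n * (-y ^ 2 / (2 * V) - (2 * (y * δ) / V + 7 * δ ^ 2 / (4 * V)))) := by
    rw [← Real.exp_add, hξ, hκ]
    congr 1
    field_simp
    ring
  rw [hexp] at hkey
  have := le_of_mul_le_mul_left hkey (Real.exp_pos _)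
  linarith [Real.exp_pos (r n * (-y ^ 2 / (2 * V) - ε))]

lemma tendsto_log_div_of_eventually_bounds {s : ℕ → ℝ} {c : ℝ} (hr : Tendsto r atTop atTop)
    (h : ∀ ε > 0, ∀ᶠ n in atTop,
      Real.exp (r n * (c - ε)) ≤ s n ∧ s n ≤ Real.exp (r n * (c + ε))) :
    Tendsto (fun n => Real.log (s n) / r n) atTop (𝓝 c) := by
  rw [Metric.tendsto_nhds]
  intro ε hε
  filter_upwards [h (ε / 2) (by positivity), hr.eventually_gt_atTop 0] with n hn hrn
  have hs : 0 < s n := (Real.exp_pos _).trans_le hn.1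
  have h1 := (Real.le_log_iff_exp_le hs).mpr hn.1
  have h2 := (Real.log_le_iff_le_exp hs).mpr hn.2
  rw [Real.dist_eq, abs_lt, lt_sub_iff_add_lt, sub_lt_iff_lt_add, lt_div_iff₀ hrn,
    div_lt_iff₀ hrn]
  constructor <;> nlinarith

end LargeDeviations

/-! ### Tensor powers -/

section TensorPower

variable {d : ℕ} {a : Fin d → ℝ}

lemma sum_tpow_mul_exp (a Y : Fin d → ℝ) (n : ℕ) :
    ∑ f, tpow a n f * Real.exp (∑ j, Y (f j)) = (∑ i, a i * Real.exp (Y i)) ^ n := by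
  simp only [tpow, Real.exp_sum, ← Finset.prod_mul_distrib]
  rw [Finset.sum_pow', Fintype.piFinset_univ]

lemma IsProbDist.tpow (ha : IsProbDist a) (n : ℕ) : IsProbDist (tpow a n) := by
  refine ⟨fun f => Finset.prod_nonneg fun j _ => ha.1 _, ?_⟩
  simpa [ha.2] using sum_tpow_mul_exp a 0 n

lemma IsProbDist.sum_mul_exp_pos (ha : IsProbDist a) (Y : Fin d → ℝ) :
    0 < ∑ i, a i * Real.exp (Y i) := by
  refine (Finset.sum_nonneg fun i _ => mul_nonneg (ha.1 i) (Real.exp_nonneg _)).lt_of_ne' ?_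
  intro h
  rw [Finset.sum_eq_zero_iff_of_nonneg
    fun i _ => mul_nonneg (ha.1 i) (Real.exp_nonneg _)] at h
  have h0 : ∑ i, a i = 0 := Finset.sum_eq_zero fun i hi =>
    (mul_eq_zero.mp (h i hi)).resolve_right (Real.exp_ne_zero _)
  linarith [ha.2]

/-- The centred information content of an outcome of `a ^ ⊗ n`, on the scale `n * τ`. -/
def scaledInfo (a : Fin d → ℝ) (τ : ℝ) (n : ℕ) (f : Fin n → Fin d) : ℝ :=
  (∑ j, (-Real.log (a (f j)) - shannonH a)) / (n * τ)

lemma tpow_eq_exp_scaledInfo (ha : IsProbDist a) {τ : ℝ} {n : ℕ} (hτ : 0 < τ) (hn : 0 < n)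
    {f : Fin n → Fin d} (hf : 0 < tpow a n f) :
    tpow a n f = Real.exp (-(n * shannonH a + scaledInfo a τ n f * n * τ)) := by
  have hpos : ∀ j, 0 < a (f j) := fun j =>
    (ha.1 _).lt_of_ne' fun h => hf.ne' (Finset.prod_eq_zero (Finset.mem_univ j) h)
  have hn' : (0 : ℝ) < n := Nat.cast_pos.mpr hn
  have h1 : scaledInfo a τ n f * n * τ = ∑ j, (-Real.log (a (f j)) - shannonH a) := by
    rw [scaledInfo]
    field_simp
  rw [h1, Finset.sum_sub_distrib, Finset.sum_neg_distrib, Finset.sum_const, Finset.card_univ,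
    Fintype.card_fin, nsmul_eq_mul]
  rw [show -(n * shannonH a + (-∑ j, Real.log (a (f j)) - n * shannonH a))
    = ∑ j, Real.log (a (f j)) by ring, Real.exp_sum]
  exact Finset.prod_congr rfl fun j _ => (Real.exp_log (hpos j)).symm

lemma ModerateSeq.eventually_pos {t : ℕ → ℝ} (ht : ModerateSeq t) : ∀ᶠ n in atTop, 0 < t n := by
  filter_upwards [ht.2.eventually_gt_atTop 0] with n hn
  exact pos_of_mul_pos_right hn (Real.sqrt_nonneg _)

lemma ModerateSeq.tendsto_speed {t : ℕ → ℝ} (ht : ModerateSeq t) :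
    Tendsto (fun n : ℕ => (n : ℝ) * t n ^ 2) atTop atTop := by
  refine (ht.2.atTop_mul_atTop₀ ht.2).congr fun n => ?_
  rw [mul_mul_mul_comm, Real.mul_self_sqrt (Nat.cast_nonneg n), sq]

lemma ModerateSeq.eventually_exp_le {t : ℕ → ℝ} (ht : ModerateSeq t) {δ : ℝ} (hδ : 0 < δ)
    (c : ℝ) : ∀ᶠ n : ℕ in atTop, Real.exp (-(δ * n * t n)) ≤ Real.exp (n * t n ^ 2 * c) := by
  have hlim : Tendsto (fun n => t n * -c) atTop (𝓝 0) := by simpa using ht.1.mul_const (-c)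
  filter_upwards [ht.eventually_pos, hlim.eventually_lt_const hδ] with n hn h
  rw [Real.exp_le_exp]
  have : (n : ℝ) * t n * (t n * -c) ≤ n * t n * δ := by gcongr
  linarith

lemma speed_mul_scaledInfo_mul (a : Fin d → ℝ) {τ : ℝ} (n : ℕ) (σ ξ : ℝ) (f : Fin n → Fin d) :
    n * τ ^ 2 * (σ * scaledInfo a τ n f) * ξ
      = ∑ j, (ξ * σ * τ) * (-Real.log (a (f j)) - shannonH a) := by
  rw [scaledInfo, ← Finset.mul_sum]
  rcases n.eq_zero_or_pos with rfl | hn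
  · simp
  · have hn' : (0 : ℝ) < n := Nat.cast_pos.mpr hn
    rcases eq_or_ne τ 0 with rfl | hτ
    · simp
    · field_simp

lemma sum_tpow_mul_exp_scaledInfo (a : Fin d → ℝ) {τ : ℝ} (n : ℕ) (σ ξ : ℝ) :
    ∑ f, tpow a n f * Real.exp (n * τ ^ 2 * (σ * scaledInfo a τ n f) * ξ)
      = (∑ i, a i * Real.exp ((ξ * σ * τ) * (-Real.log (a i) - shannonH a))) ^ n := by
  simp only [speed_mul_scaledInfo_mul]
  exact sum_tpow_mul_exp a (fun i => (ξ * σ * τ) * (-Real.log (a i) - shannonH a)) n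

lemma tendsto_cumulant_scaledInfo (ha : IsProbDist a) {t : ℕ → ℝ} (ht : ModerateSeq t)
    {σ : ℝ} (hσ : σ ^ 2 = 1) (ξ : ℝ) :
    Tendsto (fun n : ℕ => Real.log (∑ f, tpow a n f *
        Real.exp (n * t n ^ 2 * (σ * scaledInfo a (t n) n f) * ξ)) / (n * t n ^ 2))
      atTop (𝓝 (ξ ^ 2 * (entV a / 2))) := by
  simp only [sum_tpow_mul_exp_scaledInfo, Real.log_pow]
  rcases eq_or_ne ξ 0 with rfl | hξ
  · simp [ha.2]
  have hσ0 : σ ≠ 0 := by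
    rintro rfl
    norm_num at hσ
  have hmean : ∑ i, a i * (-Real.log (a i) - shannonH a) = 0 := by
    simp only [mul_sub, mul_neg, Finset.sum_sub_distrib, Finset.sum_neg_distrib,
      ← Finset.sum_mul, ha.2, shannonH]
    ring
  have hvar : ∑ i, a i * (-Real.log (a i) - shannonH a) ^ 2 = entV a :=
    Finset.sum_congr rfl fun i _ => by ring
  have hmgf := tendsto_log_mgf_div_sq ha.2 hmean
  rw [hvar] at hmgf
  have hu : Tendsto (fun n => ξ * σ * t n) atTop (𝓝[≠] 0) := by
    refine tendsto_nhdsWithin_iff.mpr ⟨by simpa using ht.1.const_mul (ξ * σ), ?_⟩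
    filter_upwards [ht.eventually_pos] with n hn
    exact mul_ne_zero (mul_ne_zero hξ hσ0) hn.ne'
  refine ((hmgf.comp hu).const_mul (ξ ^ 2)).congr' ?_
  filter_upwards [ht.eventually_pos, eventually_gt_atTop 0] with n hn hn0
  have hn' : (0 : ℝ) < n := Nat.cast_pos.mpr hn0
  simp only [Function.comp_apply]
  rw [mul_pow, mul_pow, hσ]
  field_simp

lemma sum_tpow_mul_exp_scaledInfo_pos (ha : IsProbDist a) (τ : ℝ) (n : ℕ) (σ ξ : ℝ) :
    0 < ∑ f, tpow a n f * Real.exp (n * τ ^ 2 * (σ * scaledInfo a τ n f) * ξ) := by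
  rw [sum_tpow_mul_exp_scaledInfo]
  exact pow_pos (ha.sum_mul_exp_pos _) n

lemma eventually_scaledInfo_tail_le (ha : IsProbDist a) (hV : 0 < entV a) {t : ℕ → ℝ}
    (ht : ModerateSeq t) {σ : ℝ} (hσ : σ ^ 2 = 1) {y ε : ℝ} (hy : 0 ≤ y) (hε : 0 < ε) :
    ∀ᶠ n : ℕ in atTop, ∑ f with y ≤ σ * scaledInfo a (t n) n f, tpow a n f
      ≤ Real.exp (n * t n ^ 2 * (-y ^ 2 / (2 * entV a) + ε)) :=
  eventually_tail_le (Z := fun n f => σ * scaledInfo a (t n) n f)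
    (fun n => (ha.tpow n).1) ht.tendsto_speed hV
    (fun n => sum_tpow_mul_exp_scaledInfo_pos ha (t n) n σ)
    (tendsto_cumulant_scaledInfo ha ht hσ) hy hε

lemma eventually_le_scaledInfo_tail (ha : IsProbDist a) (hV : 0 < entV a) {t : ℕ → ℝ}
    (ht : ModerateSeq t) {σ : ℝ} (hσ : σ ^ 2 = 1) {y ε : ℝ} (hy : 0 ≤ y) (hε : 0 < ε) :
    ∀ᶠ n : ℕ in atTop, Real.exp (n * t n ^ 2 * (-y ^ 2 / (2 * entV a) - ε))
      ≤ ∑ f with y ≤ σ * scaledInfo a (t n) n f, tpow a n f :=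
  eventually_le_tail (Z := fun n f => σ * scaledInfo a (t n) n f)
    (fun n => (ha.tpow n).1) ht.tendsto_speed hV
    (fun n => sum_tpow_mul_exp_scaledInfo_pos ha (t n) n σ)
    (tendsto_cumulant_scaledInfo ha ht hσ) hy hε

lemma exists_pos_abs_sq_sub_lt (x : ℝ) {V ε b : ℝ} (hε : 0 < ε) (hb : 0 < b) :
    ∃ δ : ℝ, 0 < δ ∧ δ < b ∧ |-(x + δ) ^ 2 / (2 * V) - -x ^ 2 / (2 * V)| < ε := by
  have hc : Continuous fun δ : ℝ => |-(x + δ) ^ 2 / (2 * V) - -x ^ 2 / (2 * V)| := by fun_prop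
  have h0 : ∀ᶠ δ in 𝓝[>] (0 : ℝ), |-(x + δ) ^ 2 / (2 * V) - -x ^ 2 / (2 * V)| < ε :=
    (hc.tendsto' 0 0 (by simp)).eventually_lt_const hε |>.filter_mono nhdsWithin_le_nhds
  have h1 : ∀ᶠ δ in 𝓝[>] (0 : ℝ), δ < b :=
    (eventually_lt_nhds hb).filter_mono nhdsWithin_le_nhds
  obtain ⟨δ, ⟨h, h'⟩, hδ⟩ := ((h0.and h1).and self_mem_nhdsWithin).exists
  exact ⟨δ, hδ, h', h⟩

variable {t : ℕ → ℝ} {x ε : ℝ}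

lemma eventually_le_headSum_tpow (ha : IsProbDist a) (hV : 0 < entV a) (ht : ModerateSeq t)
    (hx : x ≤ 0) (hε : 0 < ε) :
    ∀ᶠ n : ℕ in atTop, Real.exp (n * t n ^ 2 * (-x ^ 2 / (2 * entV a) - ε))
      ≤ headSum (tpow a n) (Real.exp (n * shannonH a + x * n * t n)) := by
  filter_upwards [ht.eventually_pos, eventually_gt_atTop 0,
    eventually_le_scaledInfo_tail ha hV ht (σ := -1) (by norm_num) (neg_nonneg.mpr hx) hε]
    with n hn hn0 h
  rw [neg_sq] at h
  refine h.trans (le_trans ?_ (ha.tpow n).le_headSum)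
  refine sum_filter_le_sum_filter_of_pos (ha.tpow n).1 fun f hf hz => ?_
  rw [tpow_eq_exp_scaledInfo ha hn hn0 hf, ← Real.exp_add, Real.one_le_exp_iff]
  have : scaledInfo a (t n) n f * n * t n ≤ x * n * t n := by
    gcongr
    linarith
  linarith

lemma eventually_headSum_tpow_le (ha : IsProbDist a) (hV : 0 < entV a) (ht : ModerateSeq t)
    (hx : x ≤ 0) (hε : 0 < ε) :
    ∀ᶠ n : ℕ in atTop, headSum (tpow a n) (Real.exp (n * shannonH a + x * n * t n))
      ≤ Real.exp (n * t n ^ 2 * (-x ^ 2 / (2 * entV a) + ε)) := by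
  rcases hx.eq_or_lt with rfl | hx
  · filter_upwards with n
    refine ((ha.tpow n).headSum_le_one _).trans (Real.one_le_exp ?_)
    have : -(0 : ℝ) ^ 2 / (2 * entV a) + ε = ε := by simp
    rw [this]
    positivity
  obtain ⟨δ, hδ, hδx, hδε⟩ := exists_pos_abs_sq_sub_lt x (V := entV a)
    (show 0 < ε / 3 by positivity) (neg_pos.mpr hx)
  rw [abs_lt] at hδε
  have hgap : -x ^ 2 / (2 * entV a) + 2 * ε / 3 < -x ^ 2 / (2 * entV a) + ε := by linarith
  filter_upwards [ht.eventually_pos, eventually_gt_atTop 0,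
    eventually_scaledInfo_tail_le ha hV ht (σ := -1) (by norm_num) (y := -(x + δ))
      (by linarith) (show 0 < ε / 3 by positivity),
    ht.eventually_exp_le hδ (-x ^ 2 / (2 * entV a) + 2 * ε / 3),
    eventually_two_mul_exp_le ht.tendsto_speed hgap] with n hn hn0 h hK h2
  rw [neg_sq] at h
  have hle := (ha.tpow n).headSum_le (Real.exp_nonneg (n * shannonH a + x * n * t n))
    (Real.exp_nonneg (-(n * shannonH a + (x + δ) * n * t n)))
  rw [← Real.exp_add, show n * shannonH a + x * n * t n + -(n * shannonH a + (x + δ) * n * t n)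
    = -(δ * n * t n) by ring] at hle
  have hsub : ∑ f with Real.exp (-(n * shannonH a + (x + δ) * n * t n)) < tpow a n f, tpow a n f
      ≤ ∑ f with -(x + δ) ≤ -1 * scaledInfo a (t n) n f, tpow a n f := by
    refine sum_filter_le_sum_filter_of_pos (ha.tpow n).1 fun f hf hz => ?_
    rw [tpow_eq_exp_scaledInfo ha hn hn0 hf, Real.exp_lt_exp] at hz
    have hn' : (0 : ℝ) < n * t n := mul_pos (Nat.cast_pos.mpr hn0) hn
    have : scaledInfo a (t n) n f < x + δ := lt_of_mul_lt_mul_right (by linarith) hn'.le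
    linarith
  have hmono : Real.exp (n * t n ^ 2 * (-(x + δ) ^ 2 / (2 * entV a) + ε / 3))
      ≤ Real.exp (n * t n ^ 2 * (-x ^ 2 / (2 * entV a) + 2 * ε / 3)) := by
    exact Real.exp_le_exp.mpr (mul_le_mul_of_nonneg_left (by linarith) (by positivity))
  linarith

lemma eventually_tailSum_tpow_le (ha : IsProbDist a) (hV : 0 < entV a) (ht : ModerateSeq t)
    (hx : 0 ≤ x) (hε : 0 < ε) :
    ∀ᶠ n : ℕ in atTop, tailSum (tpow a n) (Real.exp (n * shannonH a + x * n * t n))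
      ≤ Real.exp (n * t n ^ 2 * (-x ^ 2 / (2 * entV a) + ε)) := by
  filter_upwards [ht.eventually_pos, eventually_gt_atTop 0,
    eventually_scaledInfo_tail_le ha hV ht (σ := 1) (by norm_num) hx hε] with n hn hn0 h
  refine ((ha.tpow n).tailSum_le.trans ?_).trans h
  refine sum_filter_le_sum_filter_of_pos (ha.tpow n).1 fun f hf hz => ?_
  rw [tpow_eq_exp_scaledInfo ha hn hn0 hf, ← Real.exp_add, Real.exp_le_one_iff] at hz
  have hn' : (0 : ℝ) < n * t n := mul_pos (Nat.cast_pos.mpr hn0) hn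
  rw [one_mul]
  exact le_of_mul_le_mul_right (by linarith) hn'

lemma eventually_le_tailSum_tpow (ha : IsProbDist a) (hV : 0 < entV a) (ht : ModerateSeq t)
    (hx : 0 ≤ x) (hε : 0 < ε) :
    ∀ᶠ n : ℕ in atTop, Real.exp (n * t n ^ 2 * (-x ^ 2 / (2 * entV a) - ε))
      ≤ tailSum (tpow a n) (Real.exp (n * shannonH a + x * n * t n)) := by
  obtain ⟨δ, hδ, -, hδε⟩ := exists_pos_abs_sq_sub_lt x (V := entV a)
    (show 0 < ε / 3 by positivity) one_pos
  rw [abs_lt] at hδε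
  have hgap : -x ^ 2 / (2 * entV a) - ε < -x ^ 2 / (2 * entV a) - 2 * ε / 3 := by linarith
  filter_upwards [ht.eventually_pos, eventually_gt_atTop 0,
    eventually_le_scaledInfo_tail ha hV ht (σ := 1) (by norm_num) (y := x + δ)
      (by linarith) (show 0 < ε / 3 by positivity),
    ht.eventually_exp_le hδ (-x ^ 2 / (2 * entV a) - ε),
    eventually_two_mul_exp_le ht.tendsto_speed hgap] with n hn hn0 h hK h2
  have hle := (ha.tpow n).le_tailSum_add (Real.exp_nonneg (n * shannonH a + x * n * t n))
    (Real.exp_nonneg (-(n * shannonH a + (x + δ) * n * t n)))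
  rw [← Real.exp_add, show n * shannonH a + x * n * t n + -(n * shannonH a + (x + δ) * n * t n)
    = -(δ * n * t n) by ring] at hle
  have hsub : ∑ f with x + δ ≤ 1 * scaledInfo a (t n) n f, tpow a n f
      ≤ ∑ f with tpow a n f ≤ Real.exp (-(n * shannonH a + (x + δ) * n * t n)), tpow a n f := by
    refine sum_filter_le_sum_filter_of_pos (ha.tpow n).1 fun f hf hz => ?_
    rw [tpow_eq_exp_scaledInfo ha hn hn0 hf, Real.exp_le_exp]
    have : (x + δ) * n * t n ≤ scaledInfo a (t n) n f * n * t n := by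
      gcongr
      linarith
    linarith
  have hmono : Real.exp (n * t n ^ 2 * (-x ^ 2 / (2 * entV a) - 2 * ε / 3))
      ≤ Real.exp (n * t n ^ 2 * (-(x + δ) ^ 2 / (2 * entV a) - ε / 3)) := by
    exact Real.exp_le_exp.mpr (mul_le_mul_of_nonneg_left (by linarith) (by positivity))
  linarith

end TensorPower

/-- Majorisation-based tail bound for tensor powers of a distribution, in the moderate
deviation regime. -/
theorem majorisation_tail_bound
    {d : ℕ} (a : Fin d → ℝ) (ha : IsProbDist a) (hVa : 0 < entV a)
    (t : ℕ → ℝ) (ht : ModerateSeq t)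
    (k : ℕ → ℝ → ℝ)
    (hk : ∀ n : ℕ, ∀ x : ℝ, k n x = Real.exp ((n : ℝ) * shannonH a + x * n * t n)) :
    (∀ x ≤ (0 : ℝ), Tendsto (fun n : ℕ =>
        Real.log (headSum (tpow a n) (k n x)) / ((n : ℝ) * t n ^ 2))
      atTop (𝓝 (-x ^ 2 / (2 * entV a)))) ∧
    (∀ x ≥ (0 : ℝ), Tendsto (fun n : ℕ =>
        Real.log (tailSum (tpow a n) (k n x)) / ((n : ℝ) * t n ^ 2))
      atTop (𝓝 (-x ^ 2 / (2 * entV a)))) := by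

  simp only [hk]
  exact ⟨fun x hx => tendsto_log_div_of_eventually_bounds ht.tendsto_speed fun ε hε =>
      (eventually_le_headSum_tpow ha hVa ht hx hε).and (eventually_headSum_tpow_le ha hVa ht hx hε),
    fun x hx => tendsto_log_div_of_eventually_bounds ht.tendsto_speed fun ε hε =>
      (eventually_le_tailSum_tpow ha hVa ht hx hε).and (eventually_tailSum_tpow_le ha hVa ht hx hε)⟩
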